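/- arXiv:1703.01206 — 10 statements merged into one kernel-verified Lean document; each statement's English description precedes it below -/
import Mathlib

section
/- Let θ ∈ (0, 1/2] be a real number and let T_θ(x) = Int.fract(x + θ) be the rotation by θ on [0,1). Then for every x ∈ [0, 1−θ): (a) if x ∈ [0, 1−2θ) then T_θ(x) = x + θ lies in [0, 1−θ), so the first return time of x to [0, 1−θ) is 1; (b) if x ∈ [1−2θ, 1−θ) then T_θ(x) ∉ [0, 1−θ) while T_θ²(x) = x + 2θ − 1 lies in [0, 1−θ), so the first return time of x to [0, 1−θ) is 2. Moreover, writing F : [0, 1−θ) → [0, 1−θ) for the first return map (F(x) = x + θ in case (a) and F(x) = x + 2θ − 1 in case (b)), the rescaling h(x) = x/(1−θ) conjugates F to the rotation by θ/(1−θ): h(F(x)) = Int.fract( h(x) + θ/(1−θ) ) for every x ∈ [0, 1−θ). (This is the prime renormalization of the rotation by θ: after deleting a fundamental sector and gluing, the induced first return map is the rotation by cRRc(θ) = θ/(1−θ).) -/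
/-- Prime renormalization of the rotation by `θ ∈ (0, 1/2]`: first return map of
`T_θ(x) = Int.fract (x + θ)` to `[0, 1-θ)`, with return times 1 and 2, and the
rescaling `h(x) = x/(1-θ)` conjugating the first return map `F` to the rotation
by `θ/(1-θ)`. -/
theorem stmt_0 (θ : ℝ) (hθ : θ ∈ Set.Ioc (0:ℝ) (1/2))
    (T : ℝ → ℝ) (hT : ∀ x, T x = Int.fract (x + θ))
    (F : ℝ → ℝ)
    (hFa : ∀ x ∈ Set.Ico (0:ℝ) (1 - 2*θ), F x = x + θ)
    (hFb : ∀ x ∈ Set.Ico (1 - 2*θ) (1 - θ), F x = x + 2*θ - 1) :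
    ∀ x ∈ Set.Ico (0:ℝ) (1 - θ),
      (x ∈ Set.Ico (0:ℝ) (1 - 2*θ) →
        T x = x + θ ∧ T x ∈ Set.Ico (0:ℝ) (1 - θ) ∧
        IsLeast {n : ℕ | 1 ≤ n ∧ T^[n] x ∈ Set.Ico (0:ℝ) (1 - θ)} 1) ∧
      (x ∈ Set.Ico (1 - 2*θ) (1 - θ) →
        T x ∉ Set.Ico (0:ℝ) (1 - θ) ∧
        T^[2] x = x + 2*θ - 1 ∧ T^[2] x ∈ Set.Ico (0:ℝ) (1 - θ) ∧
        IsLeast {n : ℕ | 1 ≤ n ∧ T^[n] x ∈ Set.Ico (0:ℝ) (1 - θ)} 2) ∧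
      F x / (1 - θ) = Int.fract (x / (1 - θ) + θ / (1 - θ)) := by
  obtain ⟨hθ0, hθ2⟩ := hθ
  have hpos : 0 < 1 - θ := by linarith
  rintro x ⟨hx0, hx1⟩
  have hTx : T x = x + θ := by
    rw [hT, Int.fract_eq_self]
    constructor <;> linarith
  refine ⟨?_, ?_, ?_⟩
  · rintro ⟨-, hx⟩
    have hmem : T x ∈ Set.Ico (0:ℝ) (1 - θ) := by
      rw [hTx]
      constructor <;> linarith
    exact ⟨hTx, hmem, ⟨le_rfl, hmem⟩, fun n hn => hn.1⟩
  · rintro ⟨hx, -⟩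
    have hnot : T x ∉ Set.Ico (0:ℝ) (1 - θ) := by
      rw [hTx]
      rintro ⟨-, h⟩
      linarith
    have hTTx : T^[2] x = x + 2*θ - 1 := by
      change T (T x) = _
      rw [hTx, hT, Int.fract_eq_iff]
      refine ⟨by linarith, by linarith, 1, ?_⟩
      push_cast
      ring
    have hmem : T^[2] x ∈ Set.Ico (0:ℝ) (1 - θ) := by
      rw [hTTx]
      constructor <;> linarith
    refine ⟨hnot, hTTx, hmem, ⟨one_le_two, hmem⟩, ?_⟩
    rintro n ⟨hn, hnmem⟩
    by_contra! hlt
    obtain rfl : n = 1 := by omega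
    exact hnot hnmem
  · rw [← add_div]
    symm
    rw [Int.fract_eq_iff]
    rcases lt_or_ge x (1 - 2*θ) with hx | hx
    · rw [hFa x ⟨hx0, hx⟩]
      refine ⟨div_nonneg (by linarith) hpos.le, (div_lt_one hpos).2 (by linarith), 0, ?_⟩
      simp
    · rw [hFb x ⟨hx, hx1⟩]
      refine ⟨div_nonneg (by linarith) hpos.le, (div_lt_one hpos).2 (by linarith), 1, ?_⟩
      push_cast
      field_simp
      ring
end

section
/- Let θ ∈ [1/2, 1) be a real number and let T_θ(x) = Int.fract(x + θ) be the rotation by θ on [0,1). Then for every x ∈ [0, θ): (a) if x ∈ [1−θ, θ) then T_θ(x) = x + θ − 1 lies in [0, θ), so the first return time of x to [0, θ) is 1; (b) if x ∈ [0, 1−θ) then T_θ(x) ∉ [0, θ) while T_θ²(x) = x + 2θ − 1 lies in [0, θ), so the first return time of x to [0, θ) is 2. Moreover, writing F : [0, θ) → [0, θ) for the first return map (F(x) = x + θ − 1 in case (a) and F(x) = x + 2θ − 1 in case (b)), the rescaling h(x) = x/θ conjugates F to the rotation by (2θ−1)/θ: h(F(x)) = Int.fract( h(x) + (2θ−1)/θ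 ) for every x ∈ [0, θ). (This is the prime renormalization of the rotation by θ: after deleting a fundamental sector and gluing, the induced first return map is the rotation by cRRc(θ) = (2θ−1)/θ.) -/
/-- Prime renormalization of the rotation by `θ ∈ [1/2, 1)`: first return map of
`T_θ(x) = Int.fract (x + θ)` to `[0, θ)`, with return times 1 and 2, and the
rescaling `h(x) = x/θ` conjugating the first return map `F` to the rotation by
`(2θ-1)/θ`. -/
theorem stmt_1 (θ : ℝ) (hθ : θ ∈ Set.Ico (1/2 : ℝ) 1)
    (T : ℝ → ℝ) (hT : ∀ x, T x = Int.fract (x + θ))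
    (F : ℝ → ℝ)
    (hFa : ∀ x ∈ Set.Ico (1 - θ) θ, F x = x + θ - 1)
    (hFb : ∀ x ∈ Set.Ico (0:ℝ) (1 - θ), F x = x + 2*θ - 1) :
    ∀ x ∈ Set.Ico (0:ℝ) θ,
      (x ∈ Set.Ico (1 - θ) θ →
        T x = x + θ - 1 ∧ T x ∈ Set.Ico (0:ℝ) θ ∧
        IsLeast {n : ℕ | 1 ≤ n ∧ T^[n] x ∈ Set.Ico (0:ℝ) θ} 1) ∧
      (x ∈ Set.Ico (0:ℝ) (1 - θ) →
        T x ∉ Set.Ico (0:ℝ) θ ∧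
        T^[2] x = x + 2*θ - 1 ∧ T^[2] x ∈ Set.Ico (0:ℝ) θ ∧
        IsLeast {n : ℕ | 1 ≤ n ∧ T^[n] x ∈ Set.Ico (0:ℝ) θ} 2) ∧
      F x / θ = Int.fract (x / θ + (2*θ - 1) / θ) := by
  obtain ⟨hθ₁, hθ₂⟩ := hθ
  have hθ₀ : 0 < θ := by linarith
  have T_long : ∀ x ∈ Set.Ico (1 - θ) θ, T x = x + θ - 1 := by
    rintro x ⟨h₁, h₂⟩
    rw [hT, Int.fract_eq_iff]
    exact ⟨by linarith, by linarith, 1, by push_cast; ring⟩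
  have T_short : ∀ x ∈ Set.Ico (0 : ℝ) (1 - θ), T x = x + θ := by
    rintro x ⟨h₁, h₂⟩
    rw [hT, Int.fract_eq_self]
    exact ⟨by linarith, by linarith⟩
  rintro x ⟨hx₀, hx₁⟩
  refine ⟨fun h => ?_, fun h => ?_, ?_⟩
  · have hTx := T_long x h
    have hmem : T x ∈ Set.Ico (0 : ℝ) θ := by
      rw [hTx]
      exact ⟨by linarith [h.1], by linarith⟩
    exact ⟨hTx, hmem, ⟨le_rfl, hmem⟩, fun n hn => hn.1⟩
  · have hTx := T_short x h
    have hnot : T x ∉ Set.Ico (0 : ℝ) θ := by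
      rw [hTx]
      exact fun h' => by linarith [h'.2]
    have hT2 : T^[2] x = x + 2 * θ - 1 := by
      change T (T x) = _
      rw [hTx, hT, Int.fract_eq_iff]
      exact ⟨by linarith, by linarith [h.2], 1, by push_cast; ring⟩
    have hmem : T^[2] x ∈ Set.Ico (0 : ℝ) θ := by
      rw [hT2]
      exact ⟨by linarith, by linarith [h.2]⟩
    refine ⟨hnot, hT2, hmem, ⟨one_le_two, hmem⟩, ?_⟩
    rintro n ⟨hn, hnx⟩
    by_contra hlt
    obtain rfl : n = 1 := by omega
    exact hnot hnx
  · symm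
    rw [← add_div, Int.fract_eq_iff]
    rcases lt_or_ge x (1 - θ) with h | h
    · rw [hFb x ⟨hx₀, h⟩]
      refine ⟨div_nonneg (by linarith) hθ₀.le, (div_lt_one hθ₀).2 (by linarith), 0, ?_⟩
      push_cast
      ring
    · rw [hFa x ⟨h, hx₁⟩]
      refine ⟨div_nonneg (by linarith) hθ₀.le, (div_lt_one hθ₀).2 (by linarith), 1, ?_⟩
      field_simp
      push_cast
      ring
end

section
/- Let θ ∈ (0, 1/2) be irrational, let T_θ(x) = Int.fract(x + θ), and set a = ⌊1/θ⌋ (so a ≥ 2 and aθ < 1 < (a+1)θ). Then for every x ∈ [0, θ), the first return time n(x) of x to the fundamental interval [0, θ) under T_θ exists and satisfies: if x ∈ [1 − aθ, θ) then n(x) = a and T_θ^a(x) = x + aθ − 1, while if x ∈ [0, 1 − aθ) then n(x) = a + 1 and T_θ^{a+1}(x) = x + (a+1)θ − 1. In particular the first return map to the fundamental interval is given by exactly the two iterates T_θ^a and T_θ^{a+1} on the two complementary subintervals [1−aθ, θ) and [0, 1−aθ). -/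
/-- Before the orbit of `x` passes `1`, iterating the rotation is plain translation. -/
lemma iterate_fract_add_eq {θ : ℝ} (hθ : 0 ≤ θ) {T : ℝ → ℝ}
    (hT : ∀ x, T x = Int.fract (x + θ)) {x : ℝ} (hx : 0 ≤ x) (n : ℕ)
    (hn : x + n * θ < 1) : T^[n] x = x + n * θ := by
  induction n with
  | zero => simp
  | succ k ih =>
    push_cast at hn ⊢
    have hk : 0 ≤ (k : ℝ) * θ := by positivity
    rw [Function.iterate_succ_apply', ih (by linarith), hT, Int.fract_eq_self.mpr
      ⟨by linarith, by linarith⟩]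
    ring

/-- The orbit of `x ∈ [0, θ)` first returns to `[0, θ)` at the step where it passes `1`. -/
lemma isLeast_return_iterate_fract_add {θ : ℝ} (hθ₁ : θ ≤ 1) {T : ℝ → ℝ}
    (hT : ∀ x, T x = Int.fract (x + θ)) {x : ℝ} (hx : x ∈ Set.Ico 0 θ) {n : ℕ}
    (hn : x + n * θ < 1) (hn' : 1 ≤ x + (n + 1) * θ) :
    IsLeast {k : ℕ | 1 ≤ k ∧ T^[k] x ∈ Set.Ico (0 : ℝ) θ} (n + 1) ∧
      T^[n + 1] x = x + (n + 1) * θ - 1 := by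
  obtain ⟨hx₀, hxθ⟩ := hx
  have hθ₀ : 0 < θ := hx₀.trans_lt hxθ
  have hland : T^[n + 1] x = x + (n + 1) * θ - 1 := by
    rw [Function.iterate_succ_apply', iterate_fract_add_eq hθ₀.le hT hx₀ n hn, hT,
      Int.fract_eq_iff]
    exact ⟨by linarith, by linarith, 1, by push_cast; ring⟩
  refine ⟨⟨⟨by omega, ?_⟩, ?_⟩, hland⟩
  · rw [hland]
    exact ⟨by linarith, by linarith⟩
  · rintro k ⟨hk, -, hkθ⟩
    by_contra! hlt
    have hkn : (k : ℝ) ≤ n := by exact_mod_cast Nat.lt_succ_iff.mp hlt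
    have hk1 : (1 : ℝ) ≤ k := by exact_mod_cast hk
    have hkθn : (k : ℝ) * θ ≤ n * θ := by gcongr
    rw [iterate_fract_add_eq hθ₀.le hT hx₀ k (by linarith)] at hkθ
    nlinarith


/-- First return of the rotation `T_θ(x) = Int.fract (x + θ)` (with `θ ∈ (0,1/2)`
irrational) to the fundamental interval `[0, θ)`: with `a = ⌊1/θ⌋`, points of
`[1-aθ, θ)` return after exactly `a` iterates (landing at `x + aθ - 1`), and
points of `[0, 1-aθ)` return after exactly `a+1` iterates (landing at
`x + (a+1)θ - 1`). -/
theorem stmt_4 (θ : ℝ) (hθ : θ ∈ Set.Ioo (0:ℝ) (1/2)) (hirr : Irrational θ)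
    (T : ℝ → ℝ) (hT : ∀ x, T x = Int.fract (x + θ))
    (a : ℕ) (ha : (a : ℤ) = ⌊1 / θ⌋) :
    2 ≤ a ∧ (a : ℝ) * θ < 1 ∧ 1 < ((a : ℝ) + 1) * θ ∧
    ∀ x ∈ Set.Ico (0:ℝ) θ,
      (x ∈ Set.Ico (1 - (a : ℝ) * θ) θ →
        IsLeast {n : ℕ | 1 ≤ n ∧ T^[n] x ∈ Set.Ico (0:ℝ) θ} a ∧
        T^[a] x = x + (a : ℝ) * θ - 1) ∧
      (x ∈ Set.Ico (0:ℝ) (1 - (a : ℝ) * θ) →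
        IsLeast {n : ℕ | 1 ≤ n ∧ T^[n] x ∈ Set.Ico (0:ℝ) θ} (a + 1) ∧
        T^[a + 1] x = x + ((a : ℝ) + 1) * θ - 1) := by
  obtain ⟨hθ₀, hθ₁⟩ := hθ
  have hle : (a : ℝ) ≤ 1 / θ := by
    have h := Int.floor_le (1 / θ)
    rw [← ha] at h
    exact_mod_cast h
  have hlt : 1 / θ < (a : ℝ) + 1 := by
    have h := Int.lt_floor_add_one (1 / θ)
    rw [← ha] at h
    exact_mod_cast h
  rw [le_div_iff₀ hθ₀] at hle
  rw [div_lt_iff₀ hθ₀] at hlt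
  have ha2 : 2 ≤ a := by
    by_contra! h
    have h1 : (a : ℝ) ≤ 1 := by exact_mod_cast Nat.lt_succ_iff.mp h
    nlinarith
  have hne : (a : ℝ) * θ ≠ 1 := by
    simpa using (hirr.natCast_mul (by omega : a ≠ 0)).ne_one
  have hlt_one : (a : ℝ) * θ < 1 := lt_of_le_of_ne hle hne
  refine ⟨ha2, hlt_one, hlt, fun x hx => ⟨fun h => ?_, fun h => ?_⟩⟩
  · obtain ⟨n, rfl⟩ : ∃ n, a = n + 1 := ⟨a - 1, by omega⟩
    push_cast at *
    exact isLeast_return_iterate_fract_add (by linarith) hT hx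
      (by linarith [hx.2]) (by linarith [h.1])
  · exact isLeast_return_iterate_fract_add (by linarith) hT hx
      (by linarith [h.2]) (by linarith [hx.1])
end

section
/- Let θ ∈ (0, 1/2) be irrational, let T_θ(x) = Int.fract(x + θ), set a = ⌊1/θ⌋, and let F : [0, θ) → [0, θ) be the first return map of T_θ to [0, θ) (so F(x) = T_θ^{n(x)}(x) where n(x) is the least n ≥ 1 with T_θ^n(x) ∈ [0,θ)). Then the rescaling h(x) = x/θ conjugates F to the rotation of [0,1) by the angle 1 − Int.fract(1/θ): for every x ∈ [0, θ), h(F(x)) = Int.fract( h(x) + (1 − Int.fract(1/θ)) ). (Thus the sector renormalization of a rotation given by the first return to the fundamental sector is again a rotation.) -/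
theorem iterate_fract_add {θ : ℝ} {T : ℝ → ℝ} (hT : ∀ x, T x = Int.fract (x + θ))
    {x : ℝ} (hx : x ∈ Set.Ico (0 : ℝ) 1) (m : ℕ) : T^[m] x = Int.fract (x + m * θ) := by
  induction m with
  | zero => simp [Int.fract_eq_self.2 hx]
  | succ k ih =>
    rw [Function.iterate_succ_apply', ih, hT, Int.fract_eq_fract]
    refine ⟨-⌊x + k * θ⌋, ?_⟩
    rw [Int.fract]
    push_cast
    ring

/-- The first return map `F` of the rotation `T_θ(x) = Int.fract (x + θ)`
(with `θ ∈ (0,1/2)` irrational) to the fundamental interval `[0, θ)` is,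
after the rescaling `h(x) = x/θ`, the rotation of `[0,1)` by the angle
`1 - Int.fract (1/θ)`: the sector renormalization of a rotation is again a
rotation. -/
theorem stmt_5 (θ : ℝ) (hθ : θ ∈ Set.Ioo (0:ℝ) (1/2)) (hirr : Irrational θ)
    (T : ℝ → ℝ) (hT : ∀ x, T x = Int.fract (x + θ))
    (F : ℝ → ℝ)
    (hF : ∀ x ∈ Set.Ico (0:ℝ) θ, ∃ n : ℕ,
      IsLeast {m : ℕ | 1 ≤ m ∧ T^[m] x ∈ Set.Ico (0:ℝ) θ} n ∧ F x = T^[n] x) :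
    ∀ x ∈ Set.Ico (0:ℝ) θ,
      F x / θ = Int.fract (x / θ + (1 - Int.fract (1 / θ))) := by
  intro x hx
  obtain ⟨hθ0, hθ1⟩ := hθ
  obtain ⟨hx0, hxθ⟩ := hx
  obtain ⟨n, ⟨⟨hn1, hnθ⟩, hmin⟩, hFn⟩ := hF x ⟨hx0, hxθ⟩
  have hiter := iterate_fract_add hT (x := x) ⟨hx0, by linarith⟩
  have hn1' : (1 : ℝ) ≤ n := by exact_mod_cast hn1
  -- The orbit has left the fundamental interval until it wraps around.
  have hlow : 1 ≤ x + n * θ := by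
    by_contra! hlt
    rw [hiter, Int.fract_eq_self.2 ⟨by positivity, hlt⟩] at hnθ
    nlinarith [hnθ.2]
  -- The first point after wrapping around lies in the fundamental interval.
  have hup : x + n * θ < 1 + θ := by
    set N := ⌈(1 - x) / θ⌉₊ with hN
    have hpos : 0 < (1 - x) / θ := div_pos (by linarith) hθ0
    have hle : 1 - x ≤ N * θ := (div_le_iff₀ hθ0).1 (Nat.le_ceil _)
    have hlt : (N : ℝ) * θ < 1 - x + θ := by
      have h := mul_lt_mul_of_pos_right (Nat.ceil_lt_add_one hpos.le) hθ0
      rwa [add_mul, div_mul_cancel₀ _ hθ0.ne', one_mul] at h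
    have hfract : Int.fract (x + N * θ) = x + N * θ - 1 :=
      Int.fract_eq_iff.2 ⟨by linarith, by linarith, 1, by simp⟩
    have hnN : n ≤ N := hmin ⟨Nat.ceil_pos.2 hpos, by
      rw [hiter, hfract]; constructor <;> linarith⟩
    have hnN' : (n : ℝ) * θ ≤ N * θ := by gcongr
    linarith
  have hF' : F x = x + n * θ - 1 := by
    rw [hFn, hiter]
    exact Int.fract_eq_iff.2 ⟨by linarith, by linarith, 1, by simp⟩
  rw [hF', eq_comm, Int.fract_eq_iff]
  refine ⟨div_nonneg (by linarith) hθ0.le, (div_lt_one hθ0).2 (by linarith),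
    1 + ⌊1 / θ⌋ - n, ?_⟩
  rw [Int.fract]
  push_cast
  field_simp
  ring
end

section
/- Let θ ∈ (0, 1/2) be irrational and set a = ⌊1/θ⌋ (so a ≥ 2). Then for every integer k with 0 ≤ k ≤ a − 1 one has cRRc^k(θ) = θ/(1 − kθ), and cRRc^a(θ) = 1 − Int.fract(1/θ). (In particular, the first a − 1 iterates of cRRc at θ use the branch θ ↦ θ/(1−θ), the a-th iterate uses the branch θ ↦ (2θ−1)/θ, and the renormalization 𝔫(θ) prime steps needed to reach the value 1 − G(θ) equals a = a_1(θ).) -/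
/-- The prime renormalization of rotation numbers. -/
noncomputable def cRRc (θ : ℝ) : ℝ := if θ < 1/2 then θ / (1 - θ) else (2*θ - 1) / θ

theorem cRRc_div_one_sub_of_lt {θ c : ℝ} (hθ : 0 < θ) (h : (c + 2) * θ < 1) :
    cRRc (θ / (1 - c * θ)) = θ / (1 - (c + 1) * θ) := by
  have h₁ : 0 < 1 - c * θ := by linarith
  have h₂ : 0 < 1 - (c + 1) * θ := by linarith
  have hlt : θ / (1 - c * θ) < 1 / 2 := by
    rw [div_lt_div_iff₀ h₁ two_pos]
    linarith
  have hsub : 1 - θ / (1 - c * θ) = (1 - (c + 1) * θ) / (1 - c * θ) := by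
    rw [eq_div_iff h₁.ne', sub_mul, div_mul_cancel₀ _ h₁.ne']
    ring
  rw [cRRc, if_pos hlt, hsub, div_div_div_cancel_right₀ h₁.ne']

theorem cRRc_div_one_sub_of_le {θ c : ℝ} (hθ : 0 < θ) (hc : c * θ < 1)
    (h : 1 ≤ (c + 2) * θ) :
    cRRc (θ / (1 - c * θ)) = c + 2 - 1 / θ := by
  have h₁ : 0 < 1 - c * θ := by linarith
  have hge : ¬ θ / (1 - c * θ) < 1 / 2 := by
    rw [div_lt_div_iff₀ h₁ two_pos]
    linarith
  rw [cRRc, if_neg hge, sub_div, mul_div_cancel_right₀ _ (div_pos hθ h₁).ne', one_div_div,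
    sub_div, mul_div_cancel_right₀ _ hθ.ne']
  ring

theorem cRRc_iterate_eq {θ : ℝ} (hθ : 0 < θ) (k : ℕ) (h : ((k : ℝ) + 1) * θ < 1) :
    cRRc^[k] θ = θ / (1 - (k : ℝ) * θ) := by
  induction k with
  | zero => simp
  | succ k ih =>
    push_cast at h ⊢
    rw [Function.iterate_succ_apply', ih (by linarith),
      cRRc_div_one_sub_of_lt hθ (by linarith)]

/-- For irrational `θ ∈ (0,1/2)` with `a = ⌊1/θ⌋` (so `a ≥ 2`), the first `a-1`
iterates of the prime renormalization `cRRc` at `θ` are `cRRc^[k] θ = θ/(1-kθ)`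
for `0 ≤ k ≤ a-1`, and `cRRc^[a] θ = 1 - Int.fract (1/θ)`: the number of prime
steps needed to reach `1 - G(θ)` equals `a = a₁(θ)`. -/
theorem stmt_6 (θ : ℝ) (hθ : θ ∈ Set.Ioo (0:ℝ) (1/2)) (hirr : Irrational θ)
    (a : ℕ) (ha : (a : ℤ) = ⌊1 / θ⌋) :
    2 ≤ a ∧
    (∀ k : ℕ, k ≤ a - 1 → cRRc^[k] θ = θ / (1 - (k : ℝ) * θ)) ∧
    cRRc^[a] θ = 1 - Int.fract (1 / θ) := by
  obtain ⟨h0, hhalf⟩ := hθ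
  have haR : ((⌊1 / θ⌋ : ℤ) : ℝ) = a := by rw [← ha, Int.cast_natCast]
  have hle : (a : ℝ) ≤ 1 / θ := haR ▸ Int.floor_le (1 / θ)
  have hlt : 1 / θ < (a : ℝ) + 1 := haR ▸ Int.lt_floor_add_one (1 / θ)
  have hne : (a : ℝ) ≠ 1 / θ := by
    rw [one_div]
    exact (hirr.inv.ne_nat a).symm
  have haθ : (a : ℝ) * θ < 1 := (lt_div_iff₀ h0).mp (lt_of_le_of_ne hle hne)
  have hsucc : 1 < ((a : ℝ) + 1) * θ := (div_lt_iff₀ h0).mp hlt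
  have ha2 : 2 ≤ a := by
    have h2 : (2 : ℤ) ≤ ⌊1 / θ⌋ := by
      rw [Int.le_floor, le_div_iff₀ h0]
      push_cast
      linarith
    omega
  have hiter : ∀ k : ℕ, k ≤ a - 1 → cRRc^[k] θ = θ / (1 - (k : ℝ) * θ) := by
    intro k hk
    have hka : (k : ℝ) + 1 ≤ a := by
      have : k + 1 ≤ a := by omega
      exact_mod_cast this
    exact cRRc_iterate_eq h0 k ((mul_le_mul_of_nonneg_right hka h0.le).trans_lt haθ)
  refine ⟨ha2, hiter, ?_⟩
  obtain ⟨b, rfl⟩ : ∃ b, a = b + 1 := ⟨a - 1, by omega⟩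
  rw [Int.fract, haR, Function.iterate_succ_apply', hiter b (by omega)]
  push_cast at haθ hsucc ⊢
  rw [cRRc_div_one_sub_of_le h0 (by linarith) (by linarith)]
  ring
end

section
/- Let θ ∈ (0,1) be irrational and suppose G^k(θ) = θ for some integer k ≥ 1 (i.e. θ has purely periodic continued fraction expansion with period k). Then θ is periodic under the prime renormalization map: cRRc^m(θ) = θ, where m = a_1(θ) + a_2(θ) + ⋯ + a_{2k}(θ) is the sum of the first 2k partial quotients of θ. -/
/-- The Gauss map. -/
noncomputable def gaussMap (x : ℝ) : ℝ := Int.fract (1 / x)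

/-- The `n`-th partial quotient of the continued fraction expansion of `x`
(for `n ≥ 1`): `a_n(x) = ⌊1 / G^[n-1] x⌋`. -/
noncomputable def partialQuotient (n : ℕ) (x : ℝ) : ℤ := ⌊1 / gaussMap^[n - 1] x⌋

theorem cRRc_iterate_inv {y : ℝ} (hy : y ∈ Set.Ioo (0 : ℝ) 1) (n : ℕ) :
    cRRc^[n + 1] (1 / (n + 1 + y)) = 1 - y := by
  obtain ⟨h0, h1⟩ := hy
  induction n with
  | zero =>
    have h : ¬ 1 / (((0 : ℕ) : ℝ) + 1 + y) < 1 / 2 := by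
      rw [not_lt]
      apply one_div_le_one_div_of_le <;> push_cast <;> linarith
    simp only [zero_add, Function.iterate_one, cRRc, if_neg h]
    push_cast
    field_simp
    ring
  | succ n ih =>
    have hn : (0 : ℝ) ≤ n := n.cast_nonneg
    have h : 1 / (((n + 1 : ℕ) : ℝ) + 1 + y) < 1 / 2 := by
      apply one_div_lt_one_div_of_lt <;> push_cast <;> linarith
    have e : cRRc (1 / (((n + 1 : ℕ) : ℝ) + 1 + y)) = 1 / (n + 1 + y) := by
      rw [cRRc, if_pos h]
      push_cast
      have h2 : (n : ℝ) + 1 + 1 + y ≠ 0 := by positivity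
      have h3 : (n : ℝ) + 1 + y ≠ 0 := by positivity
      have h4 : 1 - 1 / ((n : ℝ) + 1 + 1 + y) = (n + 1 + y) / (n + 1 + 1 + y) := by
        field_simp
        ring
      rw [h4]
      field_simp
    rw [Function.iterate_succ_apply, e, ih]

theorem cRRc_iterate_one_sub_inv {y : ℝ} (hy : y ∈ Set.Ioo (0 : ℝ) 1) (n : ℕ) :
    cRRc^[n + 1] (1 - 1 / (n + 1 + y)) = y := by
  obtain ⟨h0, h1⟩ := hy
  induction n with
  | zero =>
    have h : 1 - 1 / (((0 : ℕ) : ℝ) + 1 + y) < 1 / 2 := by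
      have : (1 : ℝ) / 2 < 1 / (((0 : ℕ) : ℝ) + 1 + y) := by
        apply one_div_lt_one_div_of_lt <;> push_cast <;> linarith
      linarith
    simp only [zero_add, Function.iterate_one, cRRc, if_pos h]
    push_cast
    field_simp
    ring
  | succ n ih =>
    have hn : (0 : ℝ) ≤ n := n.cast_nonneg
    have h : ¬ 1 - 1 / (((n + 1 : ℕ) : ℝ) + 1 + y) < 1 / 2 := by
      have : 1 / (((n + 1 : ℕ) : ℝ) + 1 + y) < 1 / 2 := by
        apply one_div_lt_one_div_of_lt <;> push_cast <;> linarith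
      linarith
    have e : cRRc (1 - 1 / (((n + 1 : ℕ) : ℝ) + 1 + y)) = 1 - 1 / (n + 1 + y) := by
      rw [cRRc, if_neg h]
      push_cast
      have h2 : (n : ℝ) + 1 + 1 + y ≠ 0 := by positivity
      have h3 : (n : ℝ) + 1 + y ≠ 0 := by positivity
      have h4 : 1 - 1 / ((n : ℝ) + 1 + 1 + y) = (n + 1 + y) / (n + 1 + 1 + y) := by
        field_simp
        ring
      rw [h4]
      field_simp
      ring
    rw [Function.iterate_succ_apply, e, ih]

theorem irrational_gaussMap {x : ℝ} (hirr : Irrational x) : Irrational (gaussMap x) := by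
  rw [gaussMap, one_div, Int.fract]
  exact hirr.inv.sub_intCast _

theorem gaussMap_mem_Ioo {x : ℝ} (hirr : Irrational x) : gaussMap x ∈ Set.Ioo (0 : ℝ) 1 :=
  ⟨(Int.fract_nonneg _).lt_of_ne' (irrational_gaussMap hirr).ne_zero, Int.fract_lt_one _⟩

/-- Every `x ∈ (0,1)` is `1 / (a + G x)` where `a ≥ 1` is its first partial quotient. -/
theorem exists_eq_one_div_add_gaussMap {x : ℝ} (hx : x ∈ Set.Ioo (0 : ℝ) 1) :
    ∃ n : ℕ, ⌊1 / x⌋ = n + 1 ∧ x = 1 / (n + 1 + gaussMap x) := by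
  have h1 : 1 ≤ ⌊1 / x⌋ := by
    rw [Int.le_floor]
    exact_mod_cast (one_lt_one_div hx.1 hx.2).le
  obtain ⟨n, hn⟩ := Int.eq_ofNat_of_zero_le (sub_nonneg.2 h1)
  have hn' : ⌊1 / x⌋ = n + 1 := by omega
  refine ⟨n, hn', ?_⟩
  have h2 : ((n : ℝ) + 1) = (⌊1 / x⌋ : ℝ) := by rw [hn']; push_cast; rfl
  rw [h2, gaussMap, Int.floor_add_fract, one_div_one_div]

theorem cRRc_iterate_floor {x : ℝ} (hx : x ∈ Set.Ioo (0 : ℝ) 1) (hirr : Irrational x) :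
    cRRc^[⌊1 / x⌋.toNat] x = 1 - gaussMap x := by
  obtain ⟨n, hn, he⟩ := exists_eq_one_div_add_gaussMap hx
  have := cRRc_iterate_inv (gaussMap_mem_Ioo hirr) n
  rw [← he] at this
  rwa [hn]

theorem cRRc_iterate_floor_one_sub {x : ℝ} (hx : x ∈ Set.Ioo (0 : ℝ) 1) (hirr : Irrational x) :
    cRRc^[⌊1 / x⌋.toNat] (1 - x) = gaussMap x := by
  obtain ⟨n, hn, he⟩ := exists_eq_one_div_add_gaussMap hx
  have := cRRc_iterate_one_sub_inv (gaussMap_mem_Ioo hirr) n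
  rw [← he] at this
  rwa [hn]

theorem gaussMap_iterate_mem {x : ℝ} (hx : x ∈ Set.Ioo (0 : ℝ) 1) (hirr : Irrational x) (n : ℕ) :
    gaussMap^[n] x ∈ Set.Ioo (0 : ℝ) 1 ∧ Irrational (gaussMap^[n] x) := by
  induction n with
  | zero => exact ⟨hx, hirr⟩
  | succ n ih =>
    rw [Function.iterate_succ_apply']
    exact ⟨gaussMap_mem_Ioo ih.2, irrational_gaussMap ih.2⟩

theorem cRRc_iterate_sum_partialQuotient {x : ℝ} (hx : x ∈ Set.Ioo (0 : ℝ) 1)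
    (hirr : Irrational x) (j : ℕ) :
    cRRc^[∑ n ∈ Finset.range (2 * j), (partialQuotient (n + 1) x).toNat] x =
      gaussMap^[2 * j] x := by
  induction j with
  | zero => rfl
  | succ j ih =>
    obtain ⟨h1, h2⟩ := gaussMap_iterate_mem hx hirr (2 * j)
    obtain ⟨h3, h4⟩ := gaussMap_iterate_mem hx hirr (2 * j + 1)
    rw [show 2 * (j + 1) = 2 * j + 1 + 1 by ring, Finset.sum_range_succ, add_comm,
      Function.iterate_add_apply, Finset.sum_range_succ, add_comm (Finset.sum _ _),
      Function.iterate_add_apply, ih]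
    simp only [partialQuotient, Nat.add_sub_cancel]
    rw [cRRc_iterate_floor h1 h2, ← Function.iterate_succ_apply' gaussMap,
      cRRc_iterate_floor_one_sub h3 h4, ← Function.iterate_succ_apply' gaussMap]

/-- If `θ ∈ (0,1)` is irrational with purely periodic continued fraction
expansion of period `k` (i.e. `G^[k] θ = θ`), then `θ` is periodic under the
prime renormalization: `cRRc^[m] θ = θ` where `m = a₁(θ) + ⋯ + a_{2k}(θ)`. -/
theorem stmt_7 (θ : ℝ) (hθ : θ ∈ Set.Ioo (0:ℝ) 1) (hirr : Irrational θ)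
    (k : ℕ) (hk : 1 ≤ k) (hper : gaussMap^[k] θ = θ)
    (m : ℕ) (hm : (m : ℤ) = ∑ n ∈ Finset.range (2 * k), partialQuotient (n + 1) θ) :
    cRRc^[m] θ = θ := by
  have hm' : m = ∑ n ∈ Finset.range (2 * k), (partialQuotient (n + 1) θ).toNat := by
    zify
    rw [hm]
    refine Finset.sum_congr rfl fun n _ => (Int.toNat_of_nonneg ?_).symm
    exact Int.floor_nonneg.2 (one_div_nonneg.2 (gaussMap_iterate_mem hθ hirr n).1.1.le)
  rw [hm', cRRc_iterate_sum_partialQuotient hθ hirr, two_mul, Function.iterate_add_apply, hper,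
    hper]
end

section
/- If θ ∈ (0,1) is irrational and cRRc^k(θ) = θ for some integer k ≥ 1, then θ is a quadratic irrational: there exist integers A, B, C with A ≠ 0 such that Aθ² + Bθ + C = 0. (Thus every rotation number that is periodic under the prime renormalization is a periodic quadratic irrational.) -/
theorem cRRc_mem_Ico {x : ℝ} (hx : x ∈ Set.Ico (0 : ℝ) 1) : cRRc x ∈ Set.Ico (0 : ℝ) 1 := by
  obtain ⟨h0, h1⟩ := hx
  unfold cRRc
  split_ifs with h
  · exact ⟨div_nonneg h0 (by linarith), (div_lt_one (by linarith)).2 (by linarith)⟩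
  · exact ⟨div_nonneg (by linarith) h0, (div_lt_one (by linarith)).2 (by linarith)⟩

/-- In the coordinate `θ / (1 - θ)` the inverse branches of `cRRc` are `s ↦ s / (1 + s)` and
`s ↦ s + 1`, so `θ` is recovered from its `k`-th iterate by a Möbius map with nonnegative integer
coefficients, whose off-diagonal part grows with `k`. -/
theorem exists_moebius_iterate_cRRc {θ : ℝ} (hθ : θ ∈ Set.Ico (0 : ℝ) 1) (k : ℕ) :
    cRRc^[k] θ ∈ Set.Ico (0 : ℝ) 1 ∧
    ∃ a b c d : ℤ, 1 ≤ a ∧ 0 ≤ b ∧ 0 ≤ c ∧ 1 ≤ d ∧ (k : ℤ) ≤ b + c ∧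
      θ * (c * cRRc^[k] θ + d * (1 - cRRc^[k] θ)) =
        (1 - θ) * (a * cRRc^[k] θ + b * (1 - cRRc^[k] θ)) := by
  induction k with
  | zero => exact ⟨hθ, 1, 0, 0, 1, by simp [mul_comm]⟩
  | succ k ih =>
    obtain ⟨hy, a, b, c, d, ha, hb, hc, hd, hk, h⟩ := ih
    rw [Function.iterate_succ_apply']
    generalize cRRc^[k] θ = y at hy h
    refine ⟨cRRc_mem_Ico hy, ?_⟩
    obtain ⟨h0, h1⟩ := hy
    by_cases hlt : y < 1 / 2
    · refine ⟨a + b, b, c + d, d, by lia, hb, by lia, hd, by push_cast; lia, ?_⟩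
      have hne : 1 - y ≠ 0 := by linarith
      simp only [cRRc, if_pos hlt]
      push_cast
      field_simp
      linear_combination h
    · refine ⟨a, a + b, c, c + d, ha, by lia, hc, by lia, by push_cast; lia, ?_⟩
      have hne : y ≠ 0 := by linarith
      simp only [cRRc, if_neg hlt]
      push_cast
      field_simp
      linear_combination h

theorem Irrational.eq_zero_of_intCast_mul_add_eq_zero {x : ℝ} (hx : Irrational x) {m n : ℤ}
    (h : (m : ℝ) * x + n = 0) : m = 0 := by
  by_contra hm
  exact ((hx.intCast_mul hm).add_intCast n).ne_zero h

/-- Every rotation number `θ ∈ (0,1)` that is periodic under the prime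
renormalization `cRRc` is a quadratic irrational: there are integers `A, B, C`
with `A ≠ 0` and `Aθ² + Bθ + C = 0`. -/
theorem stmt_8 (θ : ℝ) (hθ : θ ∈ Set.Ioo (0:ℝ) 1) (hirr : Irrational θ)
    (k : ℕ) (hk : 1 ≤ k) (hper : cRRc^[k] θ = θ) :
    ∃ A B C : ℤ, A ≠ 0 ∧ (A : ℝ) * θ ^ 2 + (B : ℝ) * θ + (C : ℝ) = 0 := by
  obtain ⟨-, a, b, c, d, -, hb, hc, -, hbc, h⟩ :=
    exists_moebius_iterate_cRRc (Set.Ioo_subset_Ico_self hθ) k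
  rw [hper] at h
  have hq : ((c - d + a - b : ℤ) : ℝ) * θ ^ 2 + ((d - a + 2 * b : ℤ) : ℝ) * θ +
      ((-b : ℤ) : ℝ) = 0 := by
    push_cast
    linear_combination h
  refine ⟨_, _, _, fun hA => ?_, hq⟩
  rw [hA, Int.cast_zero, zero_mul, zero_add] at hq
  have hB := hirr.eq_zero_of_intCast_mul_add_eq_zero hq
  rw [hB, Int.cast_zero, zero_mul, zero_add, Int.cast_eq_zero] at hq
  lia
end

section
/- For an integer N ≥ 1, let Θ_N be the set of irrational θ ∈ (0,1) such that either a_n(θ) ≤ N for all n ≥ 1, or a_n(1−θ) ≤ N for all n ≥ 1 (rotation numbers of combinatorially bounded type, bound N). Then Θ_N is forward invariant under the prime renormalization: if θ ∈ Θ_N then cRRc(θ) ∈ Θ_N. -/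
/-- Rotation numbers of combinatorially bounded type with bound `N`:
irrational `θ ∈ (0,1)` such that all partial quotients of `θ`, or all partial
quotients of `1 - θ`, are at most `N`. -/
def ThetaBnd (N : ℕ) : Set ℝ :=
  {θ | θ ∈ Set.Ioo (0:ℝ) 1 ∧ Irrational θ ∧
    ((∀ n : ℕ, 1 ≤ n → partialQuotient n θ ≤ (N : ℤ)) ∨
     (∀ n : ℕ, 1 ≤ n → partialQuotient n (1 - θ) ≤ (N : ℤ)))}

lemma partialQuotient_succ_succ (n : ℕ) (x : ℝ) :
    partialQuotient (n + 2) x = partialQuotient (n + 1) (gaussMap x) := rfl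

lemma forall_partialQuotient_le_iff (N : ℤ) (x : ℝ) :
    (∀ n : ℕ, 1 ≤ n → partialQuotient n x ≤ N) ↔
      ⌊1 / x⌋ ≤ N ∧ ∀ n : ℕ, 1 ≤ n → partialQuotient n (gaussMap x) ≤ N := by
  constructor
  · intro h
    refine ⟨h 1 le_rfl, fun n hn => ?_⟩
    obtain ⟨m, rfl⟩ := Nat.exists_eq_add_of_le' hn
    rw [← partialQuotient_succ_succ]
    exact h _ (by omega)
  · rintro ⟨h1, h2⟩ n hn
    obtain ⟨m, rfl⟩ := Nat.exists_eq_add_of_le' hn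
    cases m with
    | zero => exact h1
    | succ m => exact h2 (m + 1) (by omega)

lemma one_div_div_one_sub {x : ℝ} (hx : x ≠ 0) : 1 / (x / (1 - x)) = 1 / x - 1 := by
  rw [one_div_div, sub_div, div_self hx]

lemma gaussMap_one_sub {x : ℝ} (h0 : 0 < x) (h : x < 1 / 2) :
    gaussMap (1 - x) = x / (1 - x) := by
  have h1 : 0 < 1 - x := by linarith
  have e : 1 / (1 - x) = x / (1 - x) + 1 := by field_simp; ring
  rw [gaussMap, e, Int.fract_add_one, Int.fract_eq_self]
  exact ⟨by positivity, by rw [div_lt_one h1]; linarith⟩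

/-- A bound on the partial quotients of `x` or of `1 - x` passes to `x / (1 - x)`. -/
lemma partialQuotient_div_one_sub_le {N : ℤ} {x : ℝ} (h0 : 0 < x) (h : x < 1 / 2)
    (hx : (∀ n : ℕ, 1 ≤ n → partialQuotient n x ≤ N) ∨
      ∀ n : ℕ, 1 ≤ n → partialQuotient n (1 - x) ≤ N) :
    ∀ n : ℕ, 1 ≤ n → partialQuotient n (x / (1 - x)) ≤ N := by
  rcases hx with hx | hx
  · rw [forall_partialQuotient_le_iff] at hx ⊢
    have e := one_div_div_one_sub h0.ne'
    have eg : gaussMap (x / (1 - x)) = gaussMap x := by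
      rw [gaussMap, e, Int.fract_sub_one, gaussMap]
    rw [eg, e, Int.floor_sub_one]
    exact ⟨by linarith [hx.1], hx.2⟩
  · rw [forall_partialQuotient_le_iff, gaussMap_one_sub h0 h] at hx
    exact hx.2

lemma irrational_div_one_sub {x : ℝ} (hx : Irrational x) : Irrational (x / (1 - x)) := by
  have e := one_div_div_one_sub hx.ne_zero
  have h : Irrational (1 / x - 1) := by
    have := hx.inv.sub_intCast 1
    rwa [Int.cast_one, ← one_div] at this
  rw [← e, one_div] at h
  exact irrational_inv_iff.mp h

lemma div_one_sub_mem_Ioo {x : ℝ} (h0 : 0 < x) (h : x < 1 / 2) :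
    x / (1 - x) ∈ Set.Ioo (0 : ℝ) 1 := by
  have h1 : 0 < 1 - x := by linarith
  exact ⟨by positivity, by rw [div_lt_one h1]; linarith⟩

lemma div_one_sub_mem_thetaBnd {N : ℕ} {x : ℝ} (hx : x ∈ ThetaBnd N) (h : x < 1 / 2) :
    x / (1 - x) ∈ ThetaBnd N :=
  ⟨div_one_sub_mem_Ioo hx.1.1 h, irrational_div_one_sub hx.2.1,
    Or.inl (partialQuotient_div_one_sub_le hx.1.1 h hx.2.2)⟩

lemma one_sub_mem_thetaBnd {N : ℕ} {x : ℝ} (hx : x ∈ ThetaBnd N) : 1 - x ∈ ThetaBnd N := by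
  obtain ⟨⟨h0, h1⟩, hirr, hb⟩ := hx
  refine ⟨⟨by linarith, by linarith⟩, ?_, ?_⟩
  · have := hirr.intCast_sub 1
    rwa [Int.cast_one] at this
  · rw [sub_sub_cancel]
    exact hb.symm

/-- The set `Θ_N` of rotation numbers of combinatorially bounded type is
forward invariant under the prime renormalization `cRRc`. -/
theorem stmt_9 (N : ℕ) (hN : 1 ≤ N) (θ : ℝ) (hθ : θ ∈ ThetaBnd N) :
    cRRc θ ∈ ThetaBnd N := by
  unfold cRRc
  split_ifs with h
  · exact div_one_sub_mem_thetaBnd hθ h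
  · have hne : θ ≠ 1 / 2 := by
      have := hθ.2.1.ne_rat (1 / 2)
      push_cast at this
      exact this
    have hlt : 1 - θ < 1 / 2 := by
      have := lt_of_le_of_ne (not_lt.mp h) hne.symm
      linarith
    have hmem := one_sub_mem_thetaBnd (div_one_sub_mem_thetaBnd (one_sub_mem_thetaBnd hθ) hlt)
    have e : (2 * θ - 1) / θ = 1 - (1 - θ) / (1 - (1 - θ)) := by
      have := hθ.1.1.ne'
      rw [sub_sub_cancel]
      field_simp
      ring
    rwa [e]
end

section
/- Fix integers q > 2 and p with 1 ≤ p ≤ q − 1 and gcd(p, q) = 1. Then there exists exactly one sequence σ : ℤ → {A, B} satisfying all of: (i) σ is q-periodic; (ii) σ(0) = A and σ(−1) = B; (iii) σ(j + p) = σ(j) for every j ∈ ℤ whose residue modulo q is neither that of −p nor that of −p − 1; (iv) σ(−p − 1) = A and σ(−p) = B. -/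
theorem Function.Periodic.eq_of_int_emod_eq {α : Type*} {σ : ℤ → α} {q : ℤ}
    (h : Function.Periodic σ q) {a b : ℤ} (hab : a % q = b % q) : σ a = σ b := by
  obtain ⟨c, hc⟩ := Int.ModEq.dvd (Int.ModEq.symm hab)
  obtain rfl : a = b + c * q := by linarith
  exact h.int_mul c b


/-- Existence and uniqueness of the `q`-periodic sequence `σ : ℤ → {A, B}`
(here `A = true`, `B = false`) encoding the combinatorics of the
`p/q`-anti-renormalization: (i) `σ` is `q`-periodic; (ii) `σ 0 = A` and
`σ (-1) = B`; (iii) `σ (j + p) = σ j` whenever the residue of `j` mod `q` is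
neither that of `-p` nor that of `-p-1`; (iv) `σ (-p-1) = A` and
`σ (-p) = B`. -/
theorem stmt_11 (q p : ℤ) (hq : 2 < q) (hp1 : 1 ≤ p) (hp2 : p ≤ q - 1)
    (hcop : Int.gcd p q = 1) :
    ∃! σ : ℤ → Bool,
      (∀ j : ℤ, σ (j + q) = σ j) ∧
      (σ 0 = true ∧ σ (-1) = false) ∧
      (∀ j : ℤ, j % q ≠ (-p) % q → j % q ≠ (-p - 1) % q → σ (j + p) = σ j) ∧
      (σ (-p - 1) = true ∧ σ (-p) = false) := by
  obtain ⟨r, s, hrs⟩ : ∃ r s : ℤ, p * r + q * s = 1 :=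
    ⟨_, _, by rw [← Int.gcd_eq_gcd_ab, hcop]; rfl⟩
  have emod_eq {a b c : ℤ} (h : a = b + q * c) (h0 : 0 ≤ b) (h1 : b < q) : a % q = b := by
    rw [h, Int.add_mul_emod_self_left, Int.emod_eq_of_lt h0 h1]
  have emod_congr {a b c : ℤ} (h : a = b + q * c) : a % q = b % q := by
    rw [h, Int.add_mul_emod_self_left]
  have lt_q (a : ℤ) : a % q < q := Int.emod_lt_of_pos a (by omega)
  have nonneg (a : ℤ) : 0 ≤ a % q := Int.emod_nonneg a (by omega)
  have index_mul (j : ℤ) : (p * ((r * j) % q)) % q = j % q := by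
    apply emod_congr (c := -(s * j) - p * (r * j / q))
    linear_combination p * Int.emod_add_mul_ediv (r * j) q + j * hrs
  obtain ⟨m, hm⟩ : ∃ m, m = (-r) % q := ⟨_, rfl⟩
  have hmq : m < q := hm ▸ lt_q _
  have hm_div : m + q * (-r / q) = -r := hm ▸ Int.emod_add_mul_ediv (-r) q
  have hm_pos : 0 < m := by
    refine lt_of_le_of_ne (hm ▸ nonneg _) fun h0 => ?_
    have hdvd : q ∣ 1 :=
      ⟨s - p * (-r / q), by linear_combination -hrs + p * h0 + p * hm_div⟩
    have := Int.le_of_dvd one_pos hdvd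
    omega
  refine ⟨fun j => decide ((r * j) % q < m), ⟨?_, ⟨?_, ?_⟩, ?_, ?_, ?_⟩, ?_⟩
  · intro j
    have h : (r * (j + q)) % q = (r * j) % q := emod_congr (c := r) (by ring)
    simp only [h]
  · simpa using hm_pos
  · have h : (r * -1) % q = m := by rw [hm]; congr 1; ring
    simp only [h, lt_irrefl, decide_false]
  · intro j h1 h2
    have hj := index_mul j
    have hk1 : (r * j) % q ≠ q - 1 := fun h => h1 <| by
      rw [← hj, h]
      exact emod_congr (c := p) (by ring)
    have hk2 : (r * j) % q ≠ m - 1 := fun h => h2 <| by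
      rw [← hj, h]
      exact emod_congr (c := s - p * (-r / q)) (by linear_combination p * hm_div - hrs)
    have hlt := lt_q (r * j)
    have hnn := nonneg (r * j)
    have h : (r * (j + p)) % q = (r * j) % q + 1 :=
      emod_eq (c := r * j / q - s)
        (by linear_combination hrs - Int.emod_add_mul_ediv (r * j) q) (by omega) (by omega)
    simp only [h, decide_eq_decide]
    omega
  · have h : (r * (-p - 1)) % q = m - 1 :=
      emod_eq (c := s + -r / q) (by linear_combination -hrs - hm_div) (by omega) (by omega)
    simp [h]
  · have h : (r * -p) % q = q - 1 :=
      emod_eq (c := s - 1) (by linear_combination -hrs) (by omega) (by omega)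
    simp only [h, decide_eq_false_iff_not]
    omega
  · rintro τ ⟨hper, ⟨h0, hneg⟩, hstep, -, -⟩
    replace hper : Function.Periodic τ q := hper
    have key (n : ℕ) : (n : ℤ) < q → τ (p * n) = decide ((n : ℤ) < m) := by
      induction n with
      | zero => simp [h0, hm_pos]
      | succ n ih =>
        intro hn
        push_cast at hn ⊢
        by_cases hnm : (n : ℤ) + 1 = m
        · rw [hper.eq_of_int_emod_eq (b := -1), hneg]
          · simp [hnm]
          · rw [hnm]
            exact emod_congr (c := s - p * (-r / q)) (by linear_combination p * hm_div - hrs)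
        · have index_ne {a b c : ℤ} (hab : r * a = b + q * c) (hb0 : 0 ≤ b) (hbq : b < q)
              (hne : (n : ℤ) ≠ b) : (p * n) % q ≠ a % q := fun h => hne <| by
            have h' : (r * (p * n)) % q = (r * a) % q := Int.ModEq.mul_left r h
            rwa [emod_eq (b := n) (c := -(s * n)) (by linear_combination n * hrs)
              (by omega) (by omega), emod_eq hab hb0 hbq] at h'
          rw [mul_add, mul_one, hstep, ih (by omega), decide_eq_decide]
          · omega
          · exact index_ne (b := q - 1) (c := s - 1) (by linear_combination -hrs)
              (by omega) (by omega) (by omega)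
          · exact index_ne (b := m - 1) (c := s + -r / q)
              (by linear_combination -hrs - hm_div) (by omega) (by omega) (by omega)
    funext j
    have h := key ((r * j) % q).toNat
    rw [Int.toNat_of_nonneg (nonneg _)] at h
    rw [← h (lt_q _)]
    exact hper.eq_of_int_emod_eq (index_mul j).symm
end

section
/- Fix integers q > 2 and p with 1 ≤ p ≤ q − 1 and gcd(p, q) = 1, let b ∈ {1, …, q−1} be the multiplicative inverse of p modulo q, and set a = q − b (so p·a ≡ −1 and p·b ≡ 1 modulo q). Define σ : ℤ → {A, B} by σ(m) = A if and only if the residue of m·b modulo q, taken in {0, 1, …, q−1}, is strictly less than a. Then σ satisfies all of: (i) σ is q-periodic; (ii) σ(0) = A and σ(−1) = B; (iii) σ(j + p) = σ(j) for every j ∈ ℤ whose residue modulo q is neither that of −p nor that of −p − 1; (iv) σ(−p − 1) = A and σ(−p) = B. Equivalently, σ(ip + jq) = A for all i ∈ {0, …, a−1}, j ∈ ℤ, and σ(−1 + ip + jq) = B for all i ∈ {0, …, b−1}, j ∈ ℤ. -/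
/-- Explicit formula for the combinatorial sequence of the
`p/q`-anti-renormalization: with `b` the inverse of `p` mod `q` (taken in
`{1,…,q-1}`) and `a = q - b` (so `p·a ≡ -1` and `p·b ≡ 1` mod `q`), the
sequence `σ(m) = A ⟺ (m·b) % q < a` (here `A = true`, `B = false`) satisfies
properties (i)–(iv) of the anti-renormalization sequence, and equivalently
`σ(ip + jq) = A` for `0 ≤ i ≤ a-1`, `j ∈ ℤ`, while `σ(-1 + ip + jq) = B` for
`0 ≤ i ≤ b-1`, `j ∈ ℤ`. -/
theorem stmt_12 (q p b a : ℤ) (hq : 2 < q) (hp1 : 1 ≤ p) (hp2 : p ≤ q - 1)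
    (hcop : Int.gcd p q = 1)
    (hb1 : 1 ≤ b) (hb2 : b ≤ q - 1) (hbinv : p * b ≡ 1 [ZMOD q])
    (ha : a = q - b)
    (σ : ℤ → Bool) (hσ : ∀ m : ℤ, σ m = true ↔ (m * b) % q < a) :
    p * a ≡ -1 [ZMOD q] ∧
    (∀ j : ℤ, σ (j + q) = σ j) ∧
    (σ 0 = true ∧ σ (-1) = false) ∧
    (∀ j : ℤ, j % q ≠ (-p) % q → j % q ≠ (-p - 1) % q → σ (j + p) = σ j) ∧
    (σ (-p - 1) = true ∧ σ (-p) = false) ∧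
    (∀ i j : ℤ, 0 ≤ i → i ≤ a - 1 → σ (i * p + j * q) = true) ∧
    (∀ i j : ℤ, 0 ≤ i → i ≤ b - 1 → σ (-1 + i * p + j * q) = false) := by
  obtain ⟨k, hk⟩ : ∃ k, p * b = 1 + q * k := by
    obtain ⟨k, hk⟩ := hbinv.symm.dvd
    exact ⟨k, by linarith⟩
  have key : ∀ m r t : ℤ, m * b = r + q * t → 0 ≤ r → r < q → (σ m = true ↔ r < a) := by
    intro m r t h h0 h1
    rw [hσ, h, Int.add_mul_emod_self_left, Int.emod_eq_of_lt h0 h1]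
  have key_false : ∀ m r t : ℤ, m * b = r + q * t → a ≤ r → r < q → σ m = false := by
    intro m r t h h0 h1
    rw [← Bool.not_eq_true, key m r t h (by omega) h1]
    omega
  have residue_eq : ∀ j s : ℤ, q ∣ j * b - s → j % q = (s * p) % q := by
    rintro j s ⟨t, ht⟩
    apply Int.ModEq.symm
    rw [Int.modEq_iff_dvd]
    exact ⟨t * p - j * k, by linear_combination p * ht - j * hk⟩
  refine ⟨?_, ?_, ⟨?_, ?_⟩, ?_, ⟨?_, ?_⟩, ?_, ?_⟩
  · rw [Int.modEq_iff_dvd]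
    exact ⟨k - p, by rw [ha]; linear_combination hk⟩
  · intro j
    rw [Bool.eq_iff_iff, hσ, hσ, add_mul, Int.add_mul_emod_self_left]
  · exact (key 0 0 0 (by ring) le_rfl (by omega)).2 (by omega)
  · exact key_false (-1) a (-1) (by rw [ha]; ring) le_rfl (by omega)
  · intro j h1 h2
    have hdiv := Int.emod_add_mul_ediv (j * b) q
    have h0 := Int.emod_nonneg (j * b) (show q ≠ 0 by omega)
    have hlt := Int.emod_lt_of_pos (j * b) (show 0 < q by omega)
    set r := (j * b) % q
    set t := (j * b) / q
    have hr1 : r ≠ q - 1 := by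
      intro hr
      apply h1
      rw [residue_eq j (-1) ⟨t + 1, by linear_combination hr - hdiv⟩]
      ring_nf
    have hr2 : r ≠ a - 1 := by
      intro hr
      apply h2
      rw [residue_eq j (-1 - b) ⟨t + 1, by rw [ha] at hr; linear_combination hr - hdiv⟩]
      apply Int.ModEq.symm
      rw [Int.modEq_iff_dvd]
      exact ⟨-k, by linear_combination -hk⟩
    rw [Bool.eq_iff_iff, key j r t hdiv.symm h0 hlt,
      key (j + p) (r + 1) (t + k) (by linear_combination hk - hdiv) (by omega) (by omega)]
    omega
  · exact (key (-p - 1) (a - 1) (-1 - k) (by rw [ha]; linear_combination -hk)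
      (by omega) (by omega)).2 (by omega)
  · exact key_false (-p) (q - 1) (-1 - k) (by linear_combination -hk) (by omega) (by omega)
  · intro i j h0 h1
    exact (key _ i (i * k + j * b) (by linear_combination i * hk) h0 (by omega)).2 (by omega)
  · intro i j h0 h1
    exact key_false _ (a + i) (i * k + j * b - 1) (by rw [ha]; linear_combination i * hk)
      (by omega) (by omega)
end
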